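/- Fix n ≥ 3 and δ ∈ (0,1). For every ε > 0 there exists a₀ > 0 such that for all λ = (λ₁,…,λₙ) with λ₁ > ⋯ > λₙ > 0 satisfying: (a) there is an index i with 1 < i < n and |λ_i − (λ₁+λₙ)/2| ≤ δ·(λ₁−λₙ)/2, and (b) a := λₙ/λ₁ ≤ a₀, the average rate of convergence satisfies ∫_{S^{n−1}} ρ*(x,λ) dμ(x) ≥ 1 − ε; in particular it is within ε of the worst-case rate (1−a)/(1+a), which itself tends to 1 as a → 0. -/

import Mathlib

open MeasureTheory Filter Finset Real Metric

noncomputable section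

/-- `qform lam k x = xᵀ Aᵏ x` for `A = diag lam`. -/
def qform {n : ℕ} (lam : Fin n → ℝ) (k : ℕ) (x : Fin n → ℝ) : ℝ :=
  ∑ i, lam i ^ k * x i ^ 2

/-- Exact line search gradient descent map for `f(x) = ½ xᵀAx`, `A = diag lam`;
`GD 0 = 0`. -/
def GD {n : ℕ} (lam : Fin n → ℝ) (x : Fin n → ℝ) : Fin n → ℝ :=
  if x = 0 then 0 else fun i => x i - qform lam 2 x / qform lam 3 x * (lam i * x i)

/-- One-step shrinking factor `ρ(x, λ)`, with the convention `ρ(0, λ) = 0`. -/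
def shrink {n : ℕ} (lam : Fin n → ℝ) (x : Fin n → ℝ) : ℝ :=
  if x = 0 then 0 else
    Real.sqrt (1 - (qform lam 2 x) ^ 2 / (qform lam 1 x * qform lam 3 x))

/-- Rate of convergence `ρ*(x⁰, λ)` of exact line search gradient descent from seed `x⁰`. -/
def rocGD {n : ℕ} (lam : Fin n → ℝ) (x0 : Fin n → ℝ) : ℝ :=
  Filter.limsup
    (fun k : ℕ => (∏ j ∈ Finset.range k, shrink lam ((GD lam)^[j] x0)) ^ ((k : ℝ)⁻¹))
    Filter.atTop

/-- The uniform (rotation invariant) probability measure on the unit sphere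
`S^{n-1} ⊆ ℝⁿ`. -/
def sphereUniform (n : ℕ) : Measure (sphere (0 : EuclideanSpace ℝ (Fin n)) 1) :=
  ((volume : Measure (EuclideanSpace ℝ (Fin n))).toSphere Set.univ)⁻¹ •
    (volume : Measure (EuclideanSpace ℝ (Fin n))).toSphere

/-- The average rate of convergence `∫_{S^{n-1}} ρ*(x, λ) dμ(x)`. -/
def avgROC (n : ℕ) (lam : Fin n → ℝ) : ℝ :=
  ∫ x : sphere (0 : EuclideanSpace ℝ (Fin n)) 1,
    rocGD lam (x : EuclideanSpace ℝ (Fin n)) ∂(sphereUniform n)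

/-- A sequence of probability vectors `p k` with means `m k` and variances `V k`, each reweighted
by the squared deviation from its mean: this is the dynamics of the squared gradient components
under exact line search. -/
structure IsReweighting {ι : Type*} [Fintype ι] (lam : ι → ℝ) (p : ℕ → ι → ℝ)
    (m V : ℕ → ℝ) : Prop where
  pos : ∀ k i, 0 < p k i
  sum_one : ∀ k, ∑ i, p k i = 1
  mean : ∀ k, ∑ i, lam i * p k i = m k
  var : ∀ k, ∑ i, (lam i - m k) ^ 2 * p k i = V k
  var_pos : ∀ k, 0 < V k
  step : ∀ k i, V k * p (k + 1) i = (lam i - m k) ^ 2 * p k i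

namespace IsReweighting

variable {ι : Type*} [Fintype ι] {lam : ι → ℝ} {p : ℕ → ι → ℝ} {m V : ℕ → ℝ}

theorem le_one (h : IsReweighting lam p m V) (k : ℕ) (i : ι) : p k i ≤ 1 := by
  rw [← h.sum_one k]
  exact Finset.single_le_sum (fun j _ => (h.pos k j).le) (Finset.mem_univ i)

theorem sum_sq_defect (h : IsReweighting lam p m V) (k : ℕ) :
    ∑ i, p k i * ((lam i - m k) * (lam i - m (k + 1)) - V k) ^ 2
      = V k * V (k + 1) - V k ^ 2 := by
  have h1 : ∑ i, p k i * ((lam i - m k) * (lam i - m (k + 1))) ^ 2 = V k * V (k + 1) := by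
    rw [← h.var (k + 1), Finset.mul_sum]
    refine Finset.sum_congr rfl fun i _ => ?_
    linear_combination -(lam i - m (k + 1)) ^ 2 * h.step k i
  have h2 : ∑ i, p k i * ((lam i - m k) * (lam i - m (k + 1))) = V k := by
    have : ∀ i, p k i * ((lam i - m k) * (lam i - m (k + 1))) =
        (lam i - m k) ^ 2 * p k i + (m k - m (k + 1)) * (lam i * p k i)
          - (m k - m (k + 1)) * m k * p k i := fun i => by ring
    simp_rw [this]
    rw [Finset.sum_sub_distrib, Finset.sum_add_distrib, ← Finset.mul_sum, ← Finset.mul_sum,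
      h.var, h.mean, h.sum_one]
    ring
  have h3 : ∀ i, p k i * ((lam i - m k) * (lam i - m (k + 1)) - V k) ^ 2 =
      p k i * ((lam i - m k) * (lam i - m (k + 1))) ^ 2
        - 2 * V k * (p k i * ((lam i - m k) * (lam i - m (k + 1)))) + V k ^ 2 * p k i :=
    fun i => by ring
  simp_rw [h3]
  rw [Finset.sum_add_distrib, Finset.sum_sub_distrib, ← Finset.mul_sum, ← Finset.mul_sum,
    h1, h2, h.sum_one]
  ring

theorem monotone_var (h : IsReweighting lam p m V) : Monotone V := by
  refine monotone_nat_of_le_succ fun k => ?_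
  have h1 : 0 ≤ V k * V (k + 1) - V k ^ 2 := by
    rw [← h.sum_sq_defect k]
    exact Finset.sum_nonneg fun i _ => mul_nonneg (h.pos k i).le (sq_nonneg _)
  have := h.var_pos k
  nlinarith

theorem sq_sub_mean_le (h : IsReweighting lam p m V) (k : ℕ) (i : ι) :
    (lam i - m k) ^ 2 ≤ (2 * ∑ j, |lam j|) ^ 2 := by
  have h1 : ∀ j, |lam j| ≤ ∑ j, |lam j| := fun j =>
    Finset.single_le_sum (f := fun j => |lam j|) (fun j _ => abs_nonneg _) (Finset.mem_univ j)
  have h2 : |m k| ≤ ∑ j, |lam j| := by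
    rw [← h.mean k]
    refine (Finset.abs_sum_le_sum_abs _ _).trans (Finset.sum_le_sum fun j _ => ?_)
    rw [abs_mul, abs_of_pos (h.pos k j)]
    exact mul_le_of_le_one_right (abs_nonneg _) (h.le_one k j)
  refine sq_le_sq' ?_ ?_ <;> linarith [h1 i, h2, abs_le.1 (h1 i), abs_le.1 h2]

theorem var_le (h : IsReweighting lam p m V) (k : ℕ) : V k ≤ (2 * ∑ j, |lam j|) ^ 2 := by
  rw [← h.var k, ← mul_one ((2 * ∑ j, |lam j|) ^ 2), ← h.sum_one k, Finset.mul_sum]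
  exact Finset.sum_le_sum fun i _ =>
    mul_le_mul_of_nonneg_right (h.sq_sub_mean_le k i) (h.pos k i).le

theorem exists_tendsto_var (h : IsReweighting lam p m V) :
    ∃ W, 0 < W ∧ Tendsto V atTop (nhds W) := by
  have hb : BddAbove (Set.range V) := ⟨_, by rintro _ ⟨k, rfl⟩; exact h.var_le k⟩
  exact ⟨_, (h.var_pos 0).trans_le (le_ciSup hb 0), tendsto_atTop_ciSup h.monotone_var hb⟩

theorem tendsto_defect (h : IsReweighting lam p m V) (i : ι) :
    Tendsto (fun k => p k i * ((lam i - m k) * (lam i - m (k + 1)) - V k) ^ 2) atTop (nhds 0) := by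
  obtain ⟨W, -, hW⟩ := h.exists_tendsto_var
  have h1 : Tendsto (fun k => V k * V (k + 1) - V k ^ 2) atTop (nhds 0) := by
    have := (hW.mul (hW.comp (tendsto_add_atTop_nat 1))).sub (hW.pow 2)
    rwa [show W * W - W ^ 2 = 0 by ring] at this
  refine squeeze_zero (fun k => mul_nonneg (h.pos k i).le (sq_nonneg _)) (fun k => ?_) h1
  rw [← h.sum_sq_defect k]
  exact Finset.single_le_sum
    (f := fun i => p k i * ((lam i - m k) * (lam i - m (k + 1)) - V k) ^ 2)
    (fun j _ => mul_nonneg (h.pos k j).le (sq_nonneg _)) (Finset.mem_univ i)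

/-- The variance about the mean is at most the second moment about any atom. -/
theorem var_le_sum_sq_sub (h : IsReweighting lam p m V) (k : ℕ) (l : ι) :
    V k ≤ ∑ i, (lam i - lam l) ^ 2 * p k i := by
  have h1 : ∑ i, (lam i - lam l) ^ 2 * p k i = V k + (m k - lam l) ^ 2 := by
    have : ∀ i, (lam i - lam l) ^ 2 * p k i = (lam i - m k) ^ 2 * p k i
        + 2 * (m k - lam l) * (lam i * p k i)
        + ((m k - lam l) ^ 2 - 2 * (m k - lam l) * m k) * p k i := fun i => by ring
    simp_rw [this]
    rw [Finset.sum_add_distrib, Finset.sum_add_distrib, ← Finset.mul_sum, ← Finset.mul_sum,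
      h.var, h.mean, h.sum_one]
    ring
  rw [h1]
  linarith [sq_nonneg (m k - lam l)]

theorem exists_two_le_card_heavy [Nonempty ι] (h : IsReweighting lam p m V) :
    ∃ c > 0, ∀ k, 2 ≤ #{i | c ≤ p k i} := by
  set B := (2 * ∑ j, |lam j|) ^ 2 with hB
  have hB0 : 0 < B := (h.var_pos 0).trans_le (h.var_le 0)
  have hn : (0 : ℝ) < Fintype.card ι := by exact_mod_cast Fintype.card_pos
  refine ⟨V 0 / (2 * (Fintype.card ι * B)), div_pos (h.var_pos 0) (by positivity), fun k => ?_⟩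
  set c := V 0 / (2 * (Fintype.card ι * B)) with hc
  have hc0 : 0 < c := div_pos (h.var_pos 0) (by positivity)
  by_contra hlt
  obtain ⟨l, hl⟩ := Finset.card_le_one_iff_subset_singleton.1 (show #{i | c ≤ p k i} ≤ 1 by omega)
  have h1 : ∑ i, (lam i - lam l) ^ 2 * p k i ≤ ∑ _i : ι, B * c := by
    refine Finset.sum_le_sum fun i _ => ?_
    by_cases hi : i = l
    · subst hi; simp; positivity
    · have h2 : p k i < c := by
        by_contra! h3
        exact hi (Finset.mem_singleton.1 (hl (by simpa using h3)))
      refine mul_le_mul ?_ h2.le (h.pos k i).le hB0.le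
      have h4 : ∀ j, |lam j| ≤ ∑ j, |lam j| := fun j =>
        Finset.single_le_sum (f := fun j => |lam j|) (fun j _ => abs_nonneg _) (Finset.mem_univ j)
      refine sq_le_sq' ?_ ?_ <;> linarith [abs_le.1 (h4 i), abs_le.1 (h4 l)]
  have h5 := (h.monotone_var (Nat.zero_le k)).trans ((h.var_le_sum_sq_sub k l).trans h1)
  rw [Finset.sum_const, Finset.card_univ, nsmul_eq_mul, ← mul_assoc, hc] at h5
  have h6 : (Fintype.card ι * B) * (V 0 / (2 * (Fintype.card ι * B))) = V 0 / 2 := by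
    field_simp
  linarith [h.var_pos 0]

theorem exists_card_small_le_two (hinj : Function.Injective lam) :
    ∃ η > 0, ∀ a b c : ℝ, #{i | |(lam i - a) * (lam i - b) - c| < η} ≤ 2 := by
  set M := ∑ j, |lam j|
  have hM : ∀ j, |lam j| ≤ M := fun j =>
    Finset.single_le_sum (f := fun j => |lam j|) (fun j _ => abs_nonneg _) (Finset.mem_univ j)
  have key : ∀ᶠ η in nhdsWithin (0 : ℝ) (Set.Ioi 0), ∀ i j k : ι, i ≠ j → i ≠ k → j ≠ k →
      6 * M * η < |(lam i - lam j) * (lam j - lam k) * (lam k - lam i)| := by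
    refine eventually_all.2 fun i => eventually_all.2 fun j => eventually_all.2 fun k => ?_
    by_cases hd : i ≠ j ∧ i ≠ k ∧ j ≠ k
    · have h1 : 0 < |(lam i - lam j) * (lam j - lam k) * (lam k - lam i)| := by
        have := sub_ne_zero.2 (hinj.ne hd.1)
        have := sub_ne_zero.2 (hinj.ne hd.2.1.symm)
        have := sub_ne_zero.2 (hinj.ne hd.2.2)
        positivity
      have h2 : Tendsto (fun η : ℝ => 6 * M * η) (nhdsWithin 0 (Set.Ioi 0)) (nhds 0) := by
        have : Tendsto (fun η : ℝ => 6 * M * η) (nhds 0) (nhds (6 * M * 0)) :=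
          (continuous_const.mul continuous_id).tendsto 0
        rw [mul_zero] at this
        exact this.mono_left nhdsWithin_le_nhds
      filter_upwards [h2.eventually_lt_const h1] with η hη _ _ _ using hη
    · exact Eventually.of_forall fun η h1 h2 h3 => absurd ⟨h1, h2, h3⟩ hd
  obtain ⟨η, hη, hη0⟩ := (key.and self_mem_nhdsWithin).exists
  refine ⟨η, hη0, fun a b c => ?_⟩
  by_contra! hlt
  obtain ⟨i, hi, j, hj, k, hk, hij, hik, hjk⟩ := Finset.two_lt_card.1 hlt
  simp only [Finset.mem_filter, Finset.mem_univ, true_and] at hi hj hk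
  have h0 := hη i j k hij hik hjk
  have hx : ∀ x y z : ι, |(lam x - a) * (lam x - b) - c| < η →
      |((lam x - a) * (lam x - b) - c) * (lam y - lam z)| ≤ η * (2 * M) := by
    intro x y z hxx
    rw [abs_mul]
    refine mul_le_mul hxx.le ?_ (abs_nonneg _) (le_of_lt hη0)
    exact (abs_sub _ _).trans (by linarith [hM y, hM z])
  have e : (lam i - lam j) * (lam j - lam k) * (lam k - lam i) =
      -(((lam i - a) * (lam i - b) - c) * (lam j - lam k)
       + ((lam j - a) * (lam j - b) - c) * (lam k - lam i)
       + ((lam k - a) * (lam k - b) - c) * (lam i - lam j)) := by ring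
  rw [e, abs_neg] at h0
  have := abs_add_three (((lam i - a) * (lam i - b) - c) * (lam j - lam k))
    (((lam j - a) * (lam j - b) - c) * (lam k - lam i))
    (((lam k - a) * (lam k - b) - c) * (lam i - lam j))
  linarith [hx i j k hi, hx j k i hj, hx k i j hk]

/-- All the mass eventually concentrates on two fixed atoms. -/
theorem exists_tendsto_quadratic [Nonempty ι] (h : IsReweighting lam p m V)
    (hinj : Function.Injective lam) :
    ∃ j l : ι, ∀ x : ℝ, Tendsto (fun k => (x - m k) * (x - m (k + 1)) - V k) atTop
      (nhds ((x - lam j) * (x - lam l))) := by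
  classical
  obtain ⟨c, hc, hheavy⟩ := h.exists_two_le_card_heavy
  obtain ⟨η, hη, hsmall⟩ := exists_card_small_le_two hinj
  set B := (2 * ∑ j, |lam j|) ^ 2 with hB
  have hB0 : 0 < B := (h.var_pos 0).trans_le (h.var_le 0)
  have hV0 := h.var_pos 0
  set c' := min c (c * V 0 / B)
  have hc' : 0 < c' := lt_min hc (by positivity)
  have hev : ∀ᶠ k in atTop, ∀ i,
      p k i * ((lam i - m k) * (lam i - m (k + 1)) - V k) ^ 2 < c' * η ^ 2 :=
    eventually_all.2 fun i => (h.tendsto_defect i).eventually_lt_const (by positivity)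
  obtain ⟨K, hK⟩ := eventually_atTop.1 hev
  have hsub : ∀ k ≥ K, ∀ i, c' ≤ p k i →
      |(lam i - m k) * (lam i - m (k + 1)) - V k| < η := by
    intro k hk i hi
    have h1 := hK k hk i
    refine abs_lt_of_sq_lt_sq ?_ hη.le
    have h2 := mul_le_mul_of_nonneg_right hi
      (sq_nonneg ((lam i - m k) * (lam i - m (k + 1)) - V k))
    exact lt_of_mul_lt_mul_left (h2.trans_lt h1) hc'.le
  let S : ℕ → Finset ι := fun k => {i | c ≤ p k i}
  have hS : ∀ k ≥ K, S (k + 1) = S k ∧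
      #(S k) = 2 := by
    intro k hk
    have hT := hsmall (m k) (m (k + 1)) (V k)
    have s1 : S k ⊆
        ({i | |(lam i - m k) * (lam i - m (k + 1)) - V k| < η} : Finset ι) := by
      intro i hi
      simp only [S, Finset.mem_filter, Finset.mem_univ, true_and] at hi ⊢
      exact hsub k hk i ((min_le_left _ _).trans hi)
    have s2 : S (k + 1) ⊆
        ({i | |(lam i - m k) * (lam i - m (k + 1)) - V k| < η} : Finset ι) := by
      intro i hi
      simp only [S, Finset.mem_filter, Finset.mem_univ, true_and] at hi ⊢
      refine hsub k hk i ((min_le_right _ _).trans ?_)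
      rw [div_le_iff₀ hB0]
      have h1 := h.step k i
      have h2 := mul_le_mul_of_nonneg_right (h.sq_sub_mean_le k i) (h.pos k i).le
      have h3 : V 0 * c ≤ V k * p (k + 1) i :=
        mul_le_mul (h.monotone_var (Nat.zero_le k)) hi hc.le (h.var_pos k).le
      linarith
    have e1 := Finset.eq_of_subset_of_card_le s1 (hT.trans (hheavy k))
    have e2 := Finset.eq_of_subset_of_card_le s2 (hT.trans (hheavy (k + 1)))
    refine ⟨e2.trans e1.symm, le_antisymm ?_ (hheavy k)⟩
    rw [e1]; exact hT
  have hconst : ∀ k ≥ K, S k = S K := by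
    intro k hk
    induction k, hk using Nat.le_induction with
    | base => rfl
    | succ k hk ih => rw [(hS k hk).1, ih]
  obtain ⟨j, l, hjl, hjlS⟩ := Finset.card_eq_two.1 (hS K le_rfl).2
  have hlim : ∀ i ∈ ({j, l} : Finset ι),
      Tendsto (fun k => (lam i - m k) * (lam i - m (k + 1)) - V k) atTop (nhds 0) := by
    intro i hi
    have h1 : Tendsto (fun k => ((lam i - m k) * (lam i - m (k + 1)) - V k) ^ 2) atTop
        (nhds 0) := by
      have h2 := (h.tendsto_defect i).div_const c
      rw [zero_div] at h2
      refine squeeze_zero' (Eventually.of_forall fun k => sq_nonneg _) ?_ h2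
      filter_upwards [eventually_ge_atTop K] with k hk
      have h3 : c ≤ p k i := by
        have : i ∈ S k := by rw [hconst k hk, hjlS]; exact hi
        simpa [S] using this
      rw [le_div_iff₀ hc, mul_comm]
      exact mul_le_mul_of_nonneg_right h3 (sq_nonneg _)
    have h4 := h1.sqrt
    simp only [Real.sqrt_sq_eq_abs, Real.sqrt_zero] at h4
    exact (tendsto_zero_iff_abs_tendsto_zero _).2 h4
  refine ⟨j, l, fun x => ?_⟩
  have hne : lam j - lam l ≠ 0 := sub_ne_zero.2 (hinj.ne hjl)
  have hj := (hlim j (by simp)).mul_const ((x - lam l) / (lam j - lam l))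
  have hl := (hlim l (by simp)).mul_const ((lam j - x) / (lam j - lam l))
  have := (hj.add hl).const_add ((x - lam j) * (x - lam l))
  simp only [zero_mul, add_zero] at this
  refine this.congr fun k => ?_
  field_simp
  ring

/-- An atom of positive mass cannot be repelling in the limit. -/
theorem abs_limit_le (h : IsReweighting lam p m V) {W q : ℝ} (hW : 0 < W)
    (hV : Tendsto V atTop (nhds W)) (i : ι)
    (hq : Tendsto (fun k => (lam i - m k) * (lam i - m (k + 1)) - V k) atTop (nhds q)) :
    |W + q| ≤ W := by
  by_contra! hlt
  have h1 : Tendsto (fun k => |(lam i - m k) * (lam i - m (k + 1))|) atTop (nhds |W + q|) := by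
    have := (hV.add hq).abs
    simpa using this
  obtain ⟨b, hb1, hb2⟩ := exists_between hlt
  have h2 : ∀ᶠ k in atTop, b < |(lam i - m k) * (lam i - m (k + 1))| :=
    h1.eventually_const_lt hb2
  obtain ⟨K, hK⟩ := eventually_atTop.1 h2
  have hb0 : 0 < b := hW.trans hb1
  have hVW : ∀ k, V k ≤ W := h.monotone_var.ge_of_tendsto hV
  have hstep : ∀ k ≥ K, (b / W) ^ 2 * p k i ≤ p (k + 2) i := by
    intro k hk
    have e : V k * V (k + 1) * p (k + 2) i =
        ((lam i - m k) * (lam i - m (k + 1))) ^ 2 * p k i := by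
      linear_combination V k * h.step (k + 1) i + (lam i - m (k + 1)) ^ 2 * h.step k i
    have h3 : b ^ 2 ≤ ((lam i - m k) * (lam i - m (k + 1))) ^ 2 := by
      rw [← sq_abs ((lam i - m k) * (lam i - m (k + 1)))]
      exact pow_le_pow_left₀ hb0.le (hK k hk).le 2
    have h4 : V k * V (k + 1) ≤ W ^ 2 := by
      rw [sq]
      exact mul_le_mul (hVW k) (hVW _) (h.var_pos _).le hW.le
    have h5 : b ^ 2 * p k i ≤ W ^ 2 * p (k + 2) i :=
      calc _ ≤ _ := mul_le_mul_of_nonneg_right h3 (h.pos k i).le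
        _ = _ := e.symm
        _ ≤ _ := mul_le_mul_of_nonneg_right h4 (h.pos _ i).le
    rw [div_pow, div_mul_eq_mul_div, div_le_iff₀ (by positivity)]
    linarith
  have hgrow : ∀ r : ℕ, ((b / W) ^ 2) ^ r * p K i ≤ p (K + 2 * r) i := by
    intro r
    induction r with
    | zero => simp
    | succ r ih =>
      have h6 := hstep (K + 2 * r) (by omega)
      rw [show K + 2 * (r + 1) = K + 2 * r + 2 by ring, pow_succ']
      refine le_trans ?_ h6
      rw [mul_assoc]
      exact mul_le_mul_of_nonneg_left ih (by positivity)
  have hgt : 1 < (b / W) ^ 2 := one_lt_pow₀ ((one_lt_div hW).2 hb1) two_ne_zero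
  obtain ⟨r, hr⟩ := (((tendsto_pow_atTop_atTop_of_one_lt hgt).atTop_mul_const
    (h.pos K i)).eventually_gt_atTop 1).exists
  linarith [hgrow r, h.le_one (K + 2 * r) i]

/-- With `t`, `b` the largest and smallest atoms, the limit cycle lives on `{t, b}` and any
other atom bounds its variance from below. -/
theorem exists_limit [Nonempty ι] (h : IsReweighting lam p m V)
    (hinj : Function.Injective lam) {t b : ι} (ht : ∀ i, lam i ≤ lam t)
    (hb : ∀ i, lam b ≤ lam i) (hbt : lam b < lam t) :
    ∃ W > 0, (∀ i, (lam t - lam i) * (lam i - lam b) ≤ 2 * W) ∧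
      Tendsto (fun k => (lam t - m k) * (lam t - m (k + 1))) atTop (nhds W) ∧
      Tendsto (fun k => m k * m (k + 1)) atTop (nhds (W + lam t * lam b)) := by
  obtain ⟨W, hW, hV⟩ := h.exists_tendsto_var
  obtain ⟨j, l, hjl⟩ := h.exists_tendsto_quadratic hinj
  have hle := fun i => abs_le.1 (h.abs_limit_le hW hV i (hjl (lam i)))
  have hlim : ∀ x, Tendsto (fun k => (x - m k) * (x - m (k + 1))) atTop
      (nhds (W + (x - lam j) * (x - lam l))) := fun x => by
    simpa using hV.add (hjl x)
  have hT : (lam t - lam j) * (lam t - lam l) = 0 :=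
    le_antisymm (by linarith [(hle t).2]) (mul_nonneg (by linarith [ht j]) (by linarith [ht l]))
  have hB : (lam b - lam j) * (lam b - lam l) = 0 :=
    le_antisymm (by linarith [(hle b).2])
      (mul_nonneg_of_nonpos_of_nonpos (by linarith [hb j]) (by linarith [hb l]))
  have hroots : ∀ x, (x - lam j) * (x - lam l) = (x - lam t) * (x - lam b) := by
    intro x
    rcases mul_eq_zero.1 hT with h1 | h1 <;> rcases mul_eq_zero.1 hB with h2 | h2
    · linarith
    · rw [← sub_eq_zero.1 h1, ← sub_eq_zero.1 h2]
    · rw [← sub_eq_zero.1 h1, ← sub_eq_zero.1 h2, mul_comm]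
    · linarith
  refine ⟨W, hW, fun i => ?_, ?_, ?_⟩
  · have := (hle i).1
    rw [hroots] at this
    linarith
  · have := hlim (lam t)
    rwa [hT, add_zero] at this
  · have := hlim 0
    rw [hroots] at this
    simpa using this

end IsReweighting

section GradientDescent

variable {n : ℕ} {lam : Fin n → ℝ}

theorem qform_nonneg (hlam : ∀ i, 0 < lam i) (k : ℕ) (x : Fin n → ℝ) : 0 ≤ qform lam k x :=
  Finset.sum_nonneg fun i _ => mul_nonneg (pow_pos (hlam i) k).le (sq_nonneg _)

theorem qform_pos (hlam : ∀ i, 0 < lam i) (k : ℕ) {x : Fin n → ℝ} (hx : x ≠ 0) :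
    0 < qform lam k x := by
  obtain ⟨i, hi⟩ := Function.ne_iff.1 hx
  have hi' : x i ≠ 0 := hi
  refine Finset.sum_pos' (fun j _ => mul_nonneg (pow_pos (hlam j) k).le (sq_nonneg _))
    ⟨i, Finset.mem_univ i, ?_⟩
  have := hlam i
  positivity

theorem GD_apply {x : Fin n → ℝ} (hx : x ≠ 0) (i : Fin n) :
    GD lam x i = x i - qform lam 2 x / qform lam 3 x * (lam i * x i) := by
  simp [GD, hx]

theorem mean_mul_GD_apply (hlam : ∀ i, 0 < lam i) {x : Fin n → ℝ} (hx : x ≠ 0) (i : Fin n) :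
    qform lam 3 x / qform lam 2 x * GD lam x i
      = (qform lam 3 x / qform lam 2 x - lam i) * x i := by
  have h2 := (qform_pos hlam 2 hx).ne'
  have h3 := (qform_pos hlam 3 hx).ne'
  rw [GD_apply hx]
  field_simp

theorem qform_one_GD (hlam : ∀ i, 0 < lam i) {x : Fin n → ℝ} (hx : x ≠ 0) :
    qform lam 1 (GD lam x) = qform lam 1 x - qform lam 2 x ^ 2 / qform lam 3 x := by
  have h3 := (qform_pos hlam 3 hx).ne'
  set s := qform lam 2 x / qform lam 3 x with hs
  have e : qform lam 1 (GD lam x)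
      = qform lam 1 x - 2 * s * qform lam 2 x + s ^ 2 * qform lam 3 x := by
    simp only [qform, Finset.mul_sum]
    rw [← Finset.sum_sub_distrib, ← Finset.sum_add_distrib]
    refine Finset.sum_congr rfl fun i _ => ?_
    rw [GD_apply hx, ← hs]
    ring
  rw [e, hs]
  field_simp
  ring

theorem shrink_eq_sqrt (hlam : ∀ i, 0 < lam i) {x : Fin n → ℝ} (hx : x ≠ 0) :
    shrink lam x = √(qform lam 1 (GD lam x) / qform lam 1 x) := by
  have h1 := (qform_pos hlam 1 hx).ne'
  have h3 := (qform_pos hlam 3 hx).ne'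
  rw [qform_one_GD hlam hx, shrink, if_neg hx]
  congr 1
  field_simp

theorem shrink_nonneg (x : Fin n → ℝ) : 0 ≤ shrink lam x := by
  unfold shrink; split_ifs <;> positivity

theorem shrink_le_one (hlam : ∀ i, 0 < lam i) (x : Fin n → ℝ) : shrink lam x ≤ 1 := by
  unfold shrink
  split_ifs with hx
  · exact zero_le_one
  · refine Real.sqrt_le_one.2 ?_
    have := qform_nonneg hlam 1 x
    have := qform_nonneg hlam 3 x
    have : 0 ≤ qform lam 2 x ^ 2 / (qform lam 1 x * qform lam 3 x) := by positivity
    linarith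

theorem prod_shrink_eq_sqrt (hlam : ∀ i, 0 < lam i) {x : Fin n → ℝ}
    (hx : ∀ k, (GD lam)^[k] x ≠ 0) (k : ℕ) :
    ∏ j ∈ Finset.range k, shrink lam ((GD lam)^[j] x)
      = √(qform lam 1 ((GD lam)^[k] x) / qform lam 1 x) := by
  induction k with
  | zero =>
    have := (qform_pos hlam 1 (hx 0)).ne'
    simp only [Function.iterate_zero, id_eq] at this
    simp [this]
  | succ k ih =>
    have h0 := qform_pos hlam 1 (hx k)
    have hx0 := qform_pos hlam 1 (hx 0)
    simp only [Function.iterate_zero, id_eq] at hx0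
    rw [Finset.prod_range_succ, ih, shrink_eq_sqrt hlam (hx k),
      ← Function.iterate_succ_apply' (GD lam) k x, ← Real.sqrt_mul (by positivity)]
    congr 1
    field_simp

theorem isReweighting_GD (hlam : ∀ i, 0 < lam i) {t b : Fin n} (hbt : lam b < lam t)
    {x : Fin n → ℝ} (hx : ∀ k i, (GD lam)^[k] x i ≠ 0) :
    ∃ p V, IsReweighting lam p
      (fun k => qform lam 3 ((GD lam)^[k] x) / qform lam 2 ((GD lam)^[k] x)) V := by
  set y : ℕ → Fin n → ℝ := fun k => (GD lam)^[k] x with hy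
  have hy0 : ∀ k, y k ≠ 0 := fun k h => hx k t (congrFun h t)
  have hQ : ∀ j k, 0 < qform lam j (y k) := fun j k => qform_pos hlam j (hy0 k)
  set m : ℕ → ℝ := fun k => qform lam 3 (y k) / qform lam 2 (y k)
  set p : ℕ → Fin n → ℝ := fun k i => lam i ^ 2 * y k i ^ 2 / qform lam 2 (y k) with hp
  have hp0 : ∀ k i, 0 < p k i := fun k i => by
    have := hlam i
    have := hx k i
    have := hQ 2 k
    positivity
  set V : ℕ → ℝ := fun k => ∑ i, (lam i - m k) ^ 2 * p k i with hV
  have hV0 : ∀ k, 0 < V k := fun k => by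
    have hex : ∃ i, lam i ≠ m k := by
      by_contra! h
      exact hbt.ne ((h b).trans (h t).symm)
    obtain ⟨i, hi⟩ := hex
    have := sub_ne_zero.2 hi
    have := hp0 k i
    exact Finset.sum_pos' (fun j _ => mul_nonneg (sq_nonneg _) (hp0 k j).le)
      ⟨i, Finset.mem_univ i, by positivity⟩
  have hstep : ∀ k i, m k * y (k + 1) i = (m k - lam i) * y k i := fun k i => by
    simpa only [hy, Function.iterate_succ_apply'] using mean_mul_GD_apply hlam (hy0 k) i
  have hQstep : ∀ k, m k ^ 2 * qform lam 2 (y (k + 1)) = V k * qform lam 2 (y k) := fun k => by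
    rw [hV, qform, Finset.mul_sum, Finset.sum_mul]
    refine Finset.sum_congr rfl fun i _ => ?_
    have h2 := (hQ 2 k).ne'
    simp only [hp]
    field_simp
    linear_combination lam i ^ 2 * (m k * y (k + 1) i + (m k - lam i) * y k i) * hstep k i
  refine ⟨p, V, hp0, fun k => ?_, fun k => ?_, fun k => rfl, hV0, fun k i => ?_⟩
  · simp only [hp]
    rw [← Finset.sum_div]
    exact div_self (hQ 2 k).ne'
  · simp only [hp]
    rw [show m k = (∑ i, lam i ^ 3 * y k i ^ 2) / qform lam 2 (y k) from rfl, Finset.sum_div]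
    refine Finset.sum_congr rfl fun i _ => ?_
    ring
  · have h2 := (hQ 2 k).ne'
    have h2' := (hQ 2 (k + 1)).ne'
    have e : V k * (lam i ^ 2 * y (k + 1) i ^ 2) * qform lam 2 (y k) =
        (lam i - m k) ^ 2 * (lam i ^ 2 * y k i ^ 2) * qform lam 2 (y (k + 1)) := by
      have h := hQstep k
      have h' := hstep k i
      linear_combination -(lam i ^ 2 * y (k + 1) i ^ 2) * h + lam i ^ 2 *
        qform lam 2 (y (k + 1)) * (m k * y (k + 1) i + (m k - lam i) * y k i) * h'
    change V k * (lam i ^ 2 * y (k + 1) i ^ 2 / qform lam 2 (y (k + 1))) =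
      (lam i - m k) ^ 2 * (lam i ^ 2 * y k i ^ 2 / qform lam 2 (y k))
    field_simp
    linear_combination e

theorem exists_mul_pow_le_of_two_step {y : ℕ → ℝ} (hy : ∀ k, 0 < y k) {s : ℝ} (hs : 0 < s)
    (h : ∀ᶠ k in atTop, s ^ 2 * y k ≤ y (k + 2)) :
    ∃ c > 0, ∀ᶠ k in atTop, c * s ^ k ≤ y k := by
  obtain ⟨K, hK⟩ := eventually_atTop.1 h
  set c := min (y K / s ^ K) (y (K + 1) / s ^ (K + 1))
  have hc : 0 < c := lt_min (div_pos (hy _) (by positivity)) (div_pos (hy _) (by positivity))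
  refine ⟨c, hc, eventually_atTop.2 ⟨K, fun k hk => ?_⟩⟩
  have : ∀ r, c * s ^ (K + r) ≤ y (K + r) ∧ c * s ^ (K + r + 1) ≤ y (K + r + 1) := by
    intro r
    induction r with
    | zero =>
      exact ⟨(le_div_iff₀ (by positivity)).1 (min_le_left _ _),
        (le_div_iff₀ (by positivity)).1 (min_le_right _ _)⟩
    | succ r ih =>
      refine ⟨ih.2, le_trans ?_ (hK (K + r) (by omega))⟩
      calc c * s ^ (K + (r + 1) + 1) = s ^ 2 * (c * s ^ (K + r)) := by ring
        _ ≤ _ := mul_le_mul_of_nonneg_left ih.1 (by positivity)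
  obtain ⟨r, rfl⟩ := Nat.exists_eq_add_of_le hk
  exact (this r).1

theorem root_prod_shrink_mem_Icc (hlam : ∀ i, 0 < lam i) (x : Fin n → ℝ) (k : ℕ) :
    (∏ j ∈ Finset.range k, shrink lam ((GD lam)^[j] x)) ^ ((k : ℝ)⁻¹) ∈ Set.Icc (0 : ℝ) 1 := by
  have h0 : 0 ≤ ∏ j ∈ Finset.range k, shrink lam ((GD lam)^[j] x) :=
    Finset.prod_nonneg fun j _ => shrink_nonneg _
  exact ⟨Real.rpow_nonneg h0 _, Real.rpow_le_one h0
    (Finset.prod_le_one (fun j _ => shrink_nonneg _) fun j _ => shrink_le_one hlam _)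
    (by positivity)⟩

theorem rocGD_mem_Icc (hlam : ∀ i, 0 < lam i) (x : Fin n → ℝ) :
    rocGD lam x ∈ Set.Icc (0 : ℝ) 1 := by
  have h := root_prod_shrink_mem_Icc hlam x
  have hb : IsBoundedUnder (· ≤ ·) atTop
      (fun k : ℕ => (∏ j ∈ Finset.range k, shrink lam ((GD lam)^[j] x)) ^ ((k : ℝ)⁻¹)) :=
    isBoundedUnder_of ⟨1, fun k => (h k).2⟩
  have hcb : IsBoundedUnder (· ≥ ·) atTop
      (fun k : ℕ => (∏ j ∈ Finset.range k, shrink lam ((GD lam)^[j] x)) ^ ((k : ℝ)⁻¹)) :=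
    isBoundedUnder_of ⟨0, fun k => (h k).1⟩
  exact ⟨le_limsup_of_frequently_le (Eventually.of_forall fun k => (h k).1).frequently hb,
    limsup_le_of_le hcb.isCoboundedUnder_le (Eventually.of_forall fun k => (h k).2)⟩

theorem le_rocGD (hlam : ∀ i, 0 < lam i) (hinj : Function.Injective lam) {t b : Fin n}
    (ht : ∀ i, lam i ≤ lam t) (hb : ∀ i, lam b ≤ lam i) (hbt : lam b < lam t)
    {x : Fin n → ℝ} (hx : ∀ k i, (GD lam)^[k] x i ≠ 0) {s : ℝ} (hs : 0 < s)
    (hsW : ∀ W > 0, (∀ i, (lam t - lam i) * (lam i - lam b) ≤ 2 * W) →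
      s ^ 2 * (W + lam t * lam b) < W) :
    s ≤ rocGD lam x := by
  have : Nonempty (Fin n) := ⟨t⟩
  obtain ⟨p, V, h⟩ := isReweighting_GD hlam hbt hx
  obtain ⟨W, hW, hW2, hlt, hl0⟩ := h.exists_limit hinj ht hb hbt
  set y : ℕ → Fin n → ℝ := fun k => (GD lam)^[k] x with hy
  set m : ℕ → ℝ := fun k => qform lam 3 (y k) / qform lam 2 (y k)
  have hy0 : ∀ k, y k ≠ 0 := fun k h => hx k t (congrFun h t)
  have hQ : ∀ j k, 0 < qform lam j (y k) := fun j k => qform_pos hlam j (hy0 k)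
  have hm0 : ∀ k, 0 < m k := fun k => div_pos (hQ 3 k) (hQ 2 k)
  have hstep : ∀ k, m k * y (k + 1) t = (m k - lam t) * y k t := fun k => by
    simpa only [hy, Function.iterate_succ_apply'] using mean_mul_GD_apply hlam (hy0 k) t
  have hev : ∀ᶠ k in atTop, s ^ 2 * |y k t| ≤ |y (k + 2) t| := by
    have hd := (hl0.const_mul (s ^ 2)).eventually_lt hlt (hsW W hW hW2)
    filter_upwards [hd] with k hk
    have hmm : 0 < m k * m (k + 1) := mul_pos (hm0 k) (hm0 _)
    have e : m k * m (k + 1) * y (k + 2) t =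
        (lam t - m k) * (lam t - m (k + 1)) * y k t := by
      linear_combination m k * hstep (k + 1) + (m (k + 1) - lam t) * hstep k
    have e' := congrArg abs e
    rw [abs_mul, abs_of_pos hmm, abs_mul] at e'
    refine le_of_mul_le_mul_left ?_ hmm
    rw [e', ← mul_assoc]
    refine mul_le_mul_of_nonneg_right ?_ (abs_nonneg _)
    refine le_trans ?_ (le_abs_self _)
    have hk' : s ^ 2 * (m k * m (k + 1)) < (lam t - m k) * (lam t - m (k + 1)) := hk
    linarith
  obtain ⟨c, hc, hck⟩ := exists_mul_pow_le_of_two_step (y := fun k => |y k t|)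
    (fun k => abs_pos.2 (hx k t)) hs hev
  have hE0 : 0 < qform lam 1 x := hQ 1 0
  set C := √(lam t / qform lam 1 x) with hC
  have hC0 : 0 < C := Real.sqrt_pos.2 (div_pos (hlam t) hE0)
  have hprod : ∀ k, C * |y k t| ≤ ∏ j ∈ Finset.range k, shrink lam ((GD lam)^[j] x) := by
    intro k
    rw [prod_shrink_eq_sqrt hlam hy0, hC, ← Real.sqrt_sq_eq_abs,
      ← Real.sqrt_mul (div_pos (hlam t) hE0).le]
    refine Real.sqrt_le_sqrt ?_
    rw [div_mul_eq_mul_div]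
    refine div_le_div_of_nonneg_right ?_ hE0.le
    have := Finset.single_le_sum (f := fun i => lam i ^ 1 * y k i ^ 2)
      (fun i _ => mul_nonneg (pow_pos (hlam i) 1).le (sq_nonneg _)) (Finset.mem_univ t)
    simpa [qform] using this
  have hlim : Tendsto (fun k : ℕ => (C * c) ^ ((k : ℝ)⁻¹) * s) atTop (nhds s) := by
    have h1 : Tendsto (fun k : ℕ => (C * c) ^ ((k : ℝ)⁻¹)) atTop (nhds ((C * c) ^ (0 : ℝ))) :=
      (Real.continuous_const_rpow (mul_pos hC0 hc).ne').continuousAt.tendsto.comp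
        tendsto_inv_atTop_nhds_zero_nat
    simpa using h1.mul_const s
  have hIcc := root_prod_shrink_mem_Icc hlam x
  unfold rocGD
  rw [← hlim.limsup_eq]
  refine limsup_le_limsup ?_ hlim.isBoundedUnder_ge.isCoboundedUnder_le
    (isBoundedUnder_of ⟨1, fun k => (hIcc k).2⟩)
  filter_upwards [hck, eventually_gt_atTop 0] with k hk hk0
  have hk0' : (k : ℝ) ≠ 0 := by exact_mod_cast hk0.ne'
  have e : (C * c) ^ ((k : ℝ)⁻¹) * s = (C * c * s ^ k) ^ ((k : ℝ)⁻¹) := by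
    rw [Real.mul_rpow (x := C * c) (by positivity) (by positivity), ← Real.rpow_natCast s k,
      ← Real.rpow_mul hs.le, mul_inv_cancel₀ hk0', Real.rpow_one]
  rw [e]
  refine Real.rpow_le_rpow (by positivity) ?_ (by positivity)
  calc C * c * s ^ k = C * (c * s ^ k) := by ring
    _ ≤ C * |y k t| := mul_le_mul_of_nonneg_left hk hC0.le
    _ ≤ _ := hprod k

end GradientDescent

section Genericity

variable {n : ℕ} {lam : Fin n → ℝ}

theorem qform_smul (k : ℕ) (c : ℝ) (x : Fin n → ℝ) :
    qform lam k (c • x) = c ^ 2 * qform lam k x := by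
  simp only [qform, Finset.mul_sum, Pi.smul_apply, smul_eq_mul]
  exact Finset.sum_congr rfl fun i _ => by ring

theorem GD_smul (c : ℝ) (x : Fin n → ℝ) : GD lam (c • x) = c • GD lam x := by
  by_cases hc : c = 0
  · simp [hc, GD]
  by_cases hx : x = 0
  · simp [hx, GD]
  ext i
  rw [GD_apply (smul_ne_zero hc hx), Pi.smul_apply, Pi.smul_apply, GD_apply hx, qform_smul,
    qform_smul, mul_div_mul_left _ _ (pow_ne_zero 2 hc), smul_eq_mul, smul_eq_mul]
  ring

/-- The polynomial map obtained from `GD` by clearing denominators. -/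
def clearedGD {n : ℕ} (lam : Fin n → ℝ) (x : Fin n → ℝ) : Fin n → ℝ :=
  fun i => (qform lam 3 x - lam i * qform lam 2 x) * x i

theorem clearedGD_eq_smul (hlam : ∀ i, 0 < lam i) (x : Fin n → ℝ) :
    clearedGD lam x = qform lam 3 x • GD lam x := by
  by_cases hx : x = 0
  · subst hx
    ext i
    simp [clearedGD, GD]
  · have h3 := (qform_pos hlam 3 hx).ne'
    ext i
    rw [Pi.smul_apply, GD_apply hx, smul_eq_mul, clearedGD]
    field_simp

theorem clearedGD_smul (c : ℝ) (x : Fin n → ℝ) :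
    clearedGD lam (c • x) = c ^ 3 • clearedGD lam x := by
  ext i
  simp only [clearedGD, qform_smul, Pi.smul_apply, smul_eq_mul]
  ring

theorem iterate_clearedGD_smul (k : ℕ) (c : ℝ) (x : Fin n → ℝ) :
    (clearedGD lam)^[k] (c • x) = c ^ 3 ^ k • (clearedGD lam)^[k] x := by
  induction k with
  | zero => simp
  | succ k ih =>
    rw [Function.iterate_succ_apply', ih, clearedGD_smul, Function.iterate_succ_apply', ← pow_mul,
      pow_succ]

theorem exists_iterate_clearedGD_eq_smul (hlam : ∀ i, 0 < lam i) (x : Fin n → ℝ) (k : ℕ) :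
    ∃ c : ℝ, (clearedGD lam)^[k] x = c • (GD lam)^[k] x := by
  induction k with
  | zero => exact ⟨1, by simp⟩
  | succ k ih =>
    obtain ⟨c, hc⟩ := ih
    refine ⟨qform lam 3 ((clearedGD lam)^[k] x) * c, ?_⟩
    rw [Function.iterate_succ_apply', clearedGD_eq_smul hlam, Function.iterate_succ_apply' (GD lam),
      mul_smul, ← GD_smul c, ← hc]

/-- Vanishes exactly when `x = 0` or the reciprocal step size at `x` equals `a`. -/
def meanDefect {n : ℕ} (lam : Fin n → ℝ) (a : ℝ) (x : Fin n → ℝ) : ℝ :=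
  qform lam 3 x - a * qform lam 2 x

theorem meanDefect_smul (a c : ℝ) (x : Fin n → ℝ) :
    meanDefect lam a (c • x) = c ^ 2 * meanDefect lam a x := by
  simp only [meanDefect, qform_smul]
  ring

theorem iterate_GD_apply_ne_zero (hlam : ∀ i, 0 < lam i) {x : Fin n → ℝ} {i : Fin n}
    (hx : x i ≠ 0) (h : ∀ k, meanDefect lam (lam i) ((clearedGD lam)^[k] x) ≠ 0) (k : ℕ) :
    (GD lam)^[k] x i ≠ 0 := by
  induction k with
  | zero => exact hx
  | succ k ih =>
    have h0 : (GD lam)^[k] x ≠ 0 := fun h' => ih (congrFun h' i)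
    have h3 := (qform_pos hlam 3 h0).ne'
    obtain ⟨c, hc⟩ := exists_iterate_clearedGD_eq_smul hlam x k
    have h1 := h k
    rw [hc, meanDefect_smul] at h1
    have h2 : clearedGD lam ((GD lam)^[k] x) i ≠ 0 := mul_ne_zero (right_ne_zero_of_mul h1) ih
    rw [clearedGD_eq_smul hlam, Pi.smul_apply, ← Function.iterate_succ_apply' (GD lam) k x] at h2
    exact right_ne_zero_of_mul h2

/-- A seed supported on the two extremal coordinates at which no iterate has mean `a`. -/
theorem exists_meanDefect_iterate_ne_zero (hlam : ∀ i, 0 < lam i) {t b : Fin n}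
    (hbt : lam b < lam t) (a : ℝ) :
    ∃ v : Fin n → ℝ, ∀ k, meanDefect lam a ((clearedGD lam)^[k] v) ≠ 0 := by
  have hne : t ≠ b := fun h => hbt.ne (by rw [h])
  have hq : ∀ (v : Fin n → ℝ), (∀ i, i ≠ t → i ≠ b → v i = 0) → ∀ k,
      qform lam k v = lam t ^ k * v t ^ 2 + lam b ^ k * v b ^ 2 := by
    intro v hv k
    rw [qform]
    refine Fintype.sum_eq_add t b hne fun i hi => ?_
    rw [hv i hi.1 hi.2]
    ring
  let good : (Fin n → ℝ) → Prop := fun v =>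
    (∀ i, i ≠ t → i ≠ b → v i = 0) ∧ v t ≠ 0 ∧ v b ≠ 0 ∧
    (lam t - a) * (lam t ^ 2 * v t ^ 2) + (lam b - a) * (lam b ^ 2 * v b ^ 2) ≠ 0 ∧
    (lam t - a) * (lam b ^ 2 * v b ^ 2) + (lam b - a) * (lam t ^ 2 * v t ^ 2) ≠ 0
  have hd : lam t - lam b ≠ 0 := (sub_pos.2 hbt).ne'
  have hstep : ∀ v, good v → good (clearedGD lam v) := by
    rintro v ⟨h0, h1, h2, h3, h4⟩
    have ht0 := (hlam t).ne'
    have hb0 := (hlam b).ne'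
    have et : clearedGD lam v t = -((lam t - lam b) * (lam b ^ 2 * v b ^ 2)) * v t := by
      rw [clearedGD, hq v h0, hq v h0]; ring
    have eb : clearedGD lam v b = ((lam t - lam b) * (lam t ^ 2 * v t ^ 2)) * v b := by
      rw [clearedGD, hq v h0, hq v h0]; ring
    have hC : (lam t - lam b) ^ 2 * (lam t ^ 2 * v t ^ 2) * (lam b ^ 2 * v b ^ 2) ≠ 0 := by
      positivity
    refine ⟨fun i hi hi' => by simp [clearedGD, h0 i hi hi'], ?_, ?_, ?_, ?_⟩
    · rw [et]; exact mul_ne_zero (neg_ne_zero.2 (by positivity)) h1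
    · rw [eb]; positivity
    · rw [et, eb]
      convert mul_ne_zero hC h4 using 1
      ring
    · rw [et, eb]
      convert mul_ne_zero hC h3 using 1
      ring
  have hiter : ∀ v, good v → ∀ k, meanDefect lam a ((clearedGD lam)^[k] v) ≠ 0 := by
    intro v hv k
    have hk : good ((clearedGD lam)^[k] v) := by
      induction k with
      | zero => exact hv
      | succ k ih => rw [Function.iterate_succ_apply']; exact hstep _ ih
    rw [meanDefect, hq _ hk.1, hq _ hk.1]
    convert hk.2.2.2.1 using 1
    ring
  have hmk : ∀ r : ℝ, 0 < r → (lam t - a) + (lam b - a) * r ^ 2 ≠ 0 →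
      (lam t - a) * r ^ 2 + (lam b - a) ≠ 0 → ∃ v, good v := by
    intro r hr h1 h2
    have ht0 := (hlam t).ne'
    have hb0 := (hlam b).ne'
    refine ⟨fun i => if i = t then (lam t)⁻¹ else if i = b then r * (lam b)⁻¹ else 0,
      fun i hi hi' => by simp [hi, hi'], by simp [ht0], by simp [hne.symm, hr.ne', hb0], ?_, ?_⟩
    · simp only [hne.symm, if_true, if_false]
      convert h1 using 1
      field_simp
    · simp only [hne.symm, if_true, if_false]
      convert h2 using 1
      field_simp
  have hex : ∃ v, good v := by
    by_cases h : (lam t - a) + (lam b - a) = 0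
    · have : 0 < lam t - a := by linarith
      refine hmk 2 two_pos ?_ ?_
      · intro h'; linarith
      · intro h'; linarith
    · exact hmk 1 one_pos (by simpa using h) (by simpa using h)
  obtain ⟨v, hv⟩ := hex
  exact ⟨v, hiter v hv⟩

theorem ae_ne_zero_of_homogeneous {E : Type*} [NormedAddCommGroup E] [NormedSpace ℝ E]
    [FiniteDimensional ℝ E] [MeasurableSpace E] [BorelSpace E] (ν : Measure E)
    [ν.IsAddHaarMeasure] {f : E → ℝ} (hf : ∀ x, AnalyticAt ℝ f x) {d : ℕ}
    (hhom : ∀ (c : ℝ) x, f (c • x) = c ^ d * f x) {v : E} (hv : f v ≠ 0) :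
    ∀ᵐ x ∂ν, f x ≠ 0 := by
  have hcont : Continuous f := continuous_iff_continuousAt.2 fun x => (hf x).continuousAt
  have hmeas : MeasurableSet {x | f x ≠ 0} :=
    (isClosed_singleton.preimage hcont).measurableSet.compl
  refine ae_mem_of_ae_add_linearMap_mem (LinearMap.toSpanSingleton ℝ E v) volume ν hmeas
    fun y => ?_
  have han : AnalyticOnNhd ℝ (fun t : ℝ => f (y + t • v)) Set.univ := fun t _ =>
    (hf (y + t • v)).fun_comp (f := fun t : ℝ => y + t • v) (by fun_prop)
  rcases han.eqOn_zero_or_eventually_ne_zero_of_preconnected isPreconnected_univ with h | h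
  · exfalso
    have h1 : ∀ᶠ s : ℝ in nhdsWithin 0 {0}ᶜ, f (v + s • y) = 0 := by
      filter_upwards [self_mem_nhdsWithin] with s hs
      have hs' : s ≠ 0 := hs
      have h2 : f (y + s⁻¹ • v) = 0 := h (Set.mem_univ s⁻¹)
      have h3 := hhom s (y + s⁻¹ • v)
      rwa [h2, mul_zero, smul_add, smul_inv_smul₀ hs', add_comm] at h3
    have h4 : Tendsto (fun s : ℝ => f (v + s • y)) (nhdsWithin 0 {0}ᶜ) (nhds (f v)) := by
      have : Continuous fun s : ℝ => f (v + s • y) := by fun_prop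
      have := this.tendsto 0
      simp only [zero_smul, add_zero] at this
      exact this.mono_left nhdsWithin_le_nhds
    exact hv (tendsto_nhds_unique (h4.congr' h1) tendsto_const_nhds)
  · have := ae_restrict_le_codiscreteWithin (μ := volume) MeasurableSet.univ h
    rw [Measure.restrict_univ] at this
    exact this

theorem ae_toSphere_ne_zero_of_homogeneous {E : Type*} [NormedAddCommGroup E] [NormedSpace ℝ E]
    [FiniteDimensional ℝ E] [MeasurableSpace E] [BorelSpace E] (ν : Measure E)
    [ν.IsAddHaarMeasure] {f : E → ℝ} (hf : ∀ x, AnalyticAt ℝ f x) {d : ℕ}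
    (hhom : ∀ (c : ℝ) x, f (c • x) = c ^ d * f x) {v : E} (hv : f v ≠ 0) :
    ∀ᵐ x : sphere (0 : E) 1 ∂ν.toSphere, f x ≠ 0 := by
  have hcont : Continuous f := continuous_iff_continuousAt.2 fun x => (hf x).continuousAt
  have hmeas : MeasurableSet {x : sphere (0 : E) 1 | ¬ f x ≠ 0} :=
    ((isClosed_singleton (x := (0 : ℝ))).preimage
      (hcont.comp continuous_subtype_val)).measurableSet.congr (by ext x; simp)
  rw [ae_iff, Measure.toSphere_apply' _ hmeas, mul_eq_zero]
  right
  refine measure_mono_null ?_ (ae_iff.1 (ae_ne_zero_of_homogeneous ν hf hhom hv))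
  rintro _ ⟨c, -, _, ⟨x, hx, rfl⟩, rfl⟩
  have hx' : f x = 0 := not_not.1 hx
  simp [hhom, hx']

theorem analyticAt_qform_comp {E : Type*} [NormedAddCommGroup E] [NormedSpace ℝ E]
    {g : E → Fin n → ℝ} {x : E} (hg : ∀ i, AnalyticAt ℝ (fun z => g z i) x) (k : ℕ) :
    AnalyticAt ℝ (fun z => qform lam k (g z)) x := by
  unfold qform
  exact Finset.analyticAt_fun_sum _ fun i _ => analyticAt_const.mul ((hg i).pow 2)

theorem analyticAt_iterate_clearedGD (k : ℕ) (x : EuclideanSpace ℝ (Fin n)) (i : Fin n) :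
    AnalyticAt ℝ (fun z : EuclideanSpace ℝ (Fin n) => (clearedGD lam)^[k] z i) x := by
  induction k generalizing i with
  | zero => exact (EuclideanSpace.proj (𝕜 := ℝ) i).analyticAt x
  | succ k ih =>
    simp only [Function.iterate_succ_apply', clearedGD]
    exact ((analyticAt_qform_comp ih 3).sub
      (analyticAt_const.mul (analyticAt_qform_comp ih 2))).mul (ih i)

theorem ae_iterate_GD_apply_ne_zero (hlam : ∀ i, 0 < lam i) {t b : Fin n}
    (hbt : lam b < lam t) :
    ∀ᵐ x : sphere (0 : EuclideanSpace ℝ (Fin n)) 1 ∂(volume.toSphere), ∀ k i,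
      (GD lam)^[k] (x : EuclideanSpace ℝ (Fin n)) i ≠ 0 := by
  have h1 : ∀ᵐ x : sphere (0 : EuclideanSpace ℝ (Fin n)) 1 ∂(volume.toSphere), ∀ i,
      (x : EuclideanSpace ℝ (Fin n)) i ≠ 0 := by
    refine ae_all_iff.2 fun i => ?_
    exact ae_toSphere_ne_zero_of_homogeneous volume
      (f := fun z : EuclideanSpace ℝ (Fin n) => z i) (d := 1)
      (v := EuclideanSpace.single i 1) (fun x => (EuclideanSpace.proj (𝕜 := ℝ) i).analyticAt x)
      (fun c x => by simp) (by simp)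
  have h2 : ∀ᵐ x : sphere (0 : EuclideanSpace ℝ (Fin n)) 1 ∂(volume.toSphere), ∀ i k,
      meanDefect lam (lam i) ((clearedGD lam)^[k] (x : EuclideanSpace ℝ (Fin n))) ≠ 0 := by
    refine ae_all_iff.2 fun i => ae_all_iff.2 fun k => ?_
    obtain ⟨v, hv⟩ := exists_meanDefect_iterate_ne_zero hlam hbt (lam i)
    refine ae_toSphere_ne_zero_of_homogeneous volume
      (f := fun z : EuclideanSpace ℝ (Fin n) => meanDefect lam (lam i) ((clearedGD lam)^[k] z))
      (d := 3 ^ k * 2) (v := WithLp.toLp 2 v) (fun x => ?_) (fun c x => ?_) (hv k)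
    · have := fun j => analyticAt_iterate_clearedGD (lam := lam) k x j
      exact (analyticAt_qform_comp this 3).sub
        (analyticAt_const.mul (analyticAt_qform_comp this 2))
    · rw [WithLp.ofLp_smul, iterate_clearedGD_smul, meanDefect_smul, pow_mul]
  filter_upwards [h1, h2] with x hx hx' k i
  exact iterate_GD_apply_ne_zero hlam (hx i) (hx' i) k

end Genericity

section Average

theorem isProbabilityMeasure_sphereUniform {n : ℕ} (hn : 0 < n) :
    IsProbabilityMeasure (sphereUniform n) := by
  have : Nonempty (Fin n) := ⟨⟨0, hn⟩⟩
  have h0 : (volume : Measure (EuclideanSpace ℝ (Fin n))).toSphere Set.univ ≠ 0 :=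
    fun h => Measure.toSphere_ne_zero _ (Measure.measure_univ_eq_zero.1 h)
  constructor
  rw [sphereUniform, Measure.smul_apply, smul_eq_mul]
  exact ENNReal.inv_mul_cancel h0 (measure_ne_top _ _)

theorem measurable_qform {n : ℕ} (lam : Fin n → ℝ) (k : ℕ) : Measurable (qform lam k) := by
  unfold qform
  fun_prop

theorem measurable_GD {n : ℕ} (lam : Fin n → ℝ) : Measurable (GD lam) := by
  unfold GD
  refine Measurable.ite (measurableSet_singleton 0) measurable_const ?_
  refine measurable_pi_lambda _ fun i => ?_
  have h2 := measurable_qform lam 2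
  have h3 := measurable_qform lam 3
  fun_prop

theorem measurable_shrink {n : ℕ} (lam : Fin n → ℝ) : Measurable (shrink lam) := by
  unfold shrink
  have h1 := measurable_qform lam 1
  have h2 := measurable_qform lam 2
  have h3 := measurable_qform lam 3
  refine Measurable.ite (measurableSet_singleton 0) measurable_const ?_
  fun_prop

theorem measurable_rocGD {n : ℕ} (lam : Fin n → ℝ) : Measurable (rocGD lam) := by
  unfold rocGD
  refine Measurable.limsup fun k => ?_
  refine Measurable.pow_const ?_ _
  exact Finset.measurable_fun_prod _ fun j _ =>
    (measurable_shrink lam).comp ((measurable_GD lam).iterate j)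

theorem le_avgROC {n : ℕ} (hn : 0 < n) {lam : Fin n → ℝ} (hlam : ∀ i, 0 < lam i) {s : ℝ}
    (h : ∀ᵐ x : sphere (0 : EuclideanSpace ℝ (Fin n)) 1 ∂(volume.toSphere),
      s ≤ rocGD lam (x : EuclideanSpace ℝ (Fin n))) :
    s ≤ avgROC n lam := by
  have := isProbabilityMeasure_sphereUniform hn
  have hmeas : Measurable fun x : sphere (0 : EuclideanSpace ℝ (Fin n)) 1 =>
      rocGD lam (x : EuclideanSpace ℝ (Fin n)) :=
    (measurable_rocGD lam).comp ((by fun_prop :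
      Continuous fun x : sphere (0 : EuclideanSpace ℝ (Fin n)) 1 =>
        ((x : EuclideanSpace ℝ (Fin n)) : Fin n → ℝ)).measurable)
  have hint : Integrable (fun x : sphere (0 : EuclideanSpace ℝ (Fin n)) 1 =>
      rocGD lam (x : EuclideanSpace ℝ (Fin n))) (sphereUniform n) :=
    Integrable.of_bound hmeas.aestronglyMeasurable 1 (Eventually.of_forall fun x => by
      have := rocGD_mem_Icc hlam (x : EuclideanSpace ℝ (Fin n))
      rw [Real.norm_eq_abs, abs_of_nonneg this.1]
      exact this.2)
  have h' : ∀ᵐ x : sphere (0 : EuclideanSpace ℝ (Fin n)) 1 ∂(sphereUniform n),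
      s ≤ rocGD lam (x : EuclideanSpace ℝ (Fin n)) :=
    Measure.ae_smul_measure h _
  have := integral_mono_ae (integrable_const s) hint h'
  simpa [avgROC] using this

end Average

/-- with an intermediate eigenvalue bounded away (relative gap `δ`) from the
extremal ones, the average ROC approaches `1` (the worst case) as the condition number
tends to `∞`. -/
theorem average_roc_tendsto_one_of_intermediate_eigenvalue (n : ℕ) (hn : 3 ≤ n)
    (δ : ℝ) (hδ : δ ∈ Set.Ioo (0 : ℝ) 1) (ε : ℝ) (hε : 0 < ε) :
    ∃ a₀ > (0 : ℝ), ∀ lam : Fin n → ℝ,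
      (∀ i j : Fin n, i < j → lam j < lam i) →
      0 < lam ⟨n - 1, by omega⟩ →
      (∃ i : Fin n, 0 < (i : ℕ) ∧ (i : ℕ) < n - 1 ∧
        |lam i - (lam ⟨0, by omega⟩ + lam ⟨n - 1, by omega⟩) / 2| ≤
          δ * (lam ⟨0, by omega⟩ - lam ⟨n - 1, by omega⟩) / 2) →
      lam ⟨n - 1, by omega⟩ / lam ⟨0, by omega⟩ ≤ a₀ →
      1 - ε ≤ avgROC n lam := by
  set η := min ε (1 / 2) with hη
  have hη0 : 0 < η := lt_min hε (by norm_num)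
  have hη1 : η ≤ 1 / 2 := min_le_right _ _
  have hδ' : 0 < 1 - δ ^ 2 := by nlinarith [hδ.1, hδ.2]
  refine ⟨min (1 / 2) (η * (1 - δ ^ 2) / 32), lt_min (by norm_num) (by positivity), ?_⟩
  intro lam hanti hpos hmid hcond
  set t : Fin n := ⟨0, by omega⟩ with ht_def
  set b : Fin n := ⟨n - 1, by omega⟩ with hb_def
  have hanti' : StrictAnti lam := fun i j h => hanti i j h
  have ht : ∀ i, lam i ≤ lam t := fun i => hanti'.antitone (Fin.mk_le_of_le_val (Nat.zero_le _))
  have hb : ∀ i, lam b ≤ lam i := fun i =>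
    hanti'.antitone (Fin.le_def.2 (by have := i.2; simp only [hb_def]; omega))
  have hlam : ∀ i, 0 < lam i := fun i => hpos.trans_le (hb i)
  have hbt : lam b < lam t := hanti t b (Fin.lt_def.2 (by simp only [hb_def, ht_def]; omega))
  obtain ⟨i, -, -, hi⟩ := hmid
  refine le_trans (sub_le_sub_left (min_le_left ε (1 / 2)) 1) ?_
  rw [← hη]
  refine le_avgROC (by omega) hlam ?_
  filter_upwards [ae_iterate_GD_apply_ne_zero hlam hbt] with x hx
  refine le_rocGD hlam hanti'.injective ht hb hbt hx (by linarith) fun W hW hW2 => ?_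
  have hT := hlam t
  have hB := hlam b
  have hc1 : lam b ≤ 1 / 2 * lam t :=
    (div_le_iff₀ hT).1 (hcond.trans (min_le_left _ _))
  have hc2 : lam b ≤ η * (1 - δ ^ 2) / 32 * lam t :=
    (div_le_iff₀ hT).1 (hcond.trans (min_le_right _ _))
  have hsq : (lam i - (lam t + lam b) / 2) ^ 2 ≤ (δ * (lam t - lam b) / 2) ^ 2 :=
    sq_le_sq' (abs_le.1 hi).1 (abs_le.1 hi).2
  have hd : (lam t / 2) ^ 2 ≤ (lam t - lam b) ^ 2 :=
    pow_le_pow_left₀ (by positivity) (by linarith) 2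
  have hWl : (1 - δ ^ 2) * (lam t / 2) ^ 2 ≤ 8 * W := by
    have := hW2 i
    have := mul_le_mul_of_nonneg_left hd hδ'.le
    nlinarith
  have hprod : lam t * lam b ≤ η * W := by
    have h1 := mul_le_mul_of_nonneg_left hc2 hT.le
    have h2 := mul_le_mul_of_nonneg_left hWl hη0.le
    nlinarith
  have h1 : (1 - η) ^ 2 * (W + lam t * lam b) ≤ (1 - η) ^ 2 * (W + η * W) :=
    mul_le_mul_of_nonneg_left (by linarith) (sq_nonneg _)
  have h2 : (1 - η) ^ 2 * (W + η * W) = W - W * (η * (1 + η * (1 - η))) := by ring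
  have h3 : 0 < W * (η * (1 + η * (1 - η))) := by
    have : 0 ≤ 1 - η := by linarith
    positivity
  linarith

end
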